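/- arXiv:1606.00133 — 10 statements merged into one kernel-verified Lean document; each statement's English description precedes it below -/
import Mathlib

section
/- Let φ : ι → Set (U × U) be a JEPD interpretation and conv : ι → Set ι a symbolic converse. If conv is weak, i.e. conv r = ⋂ {S : Set ι | Φ(S) ⊇ (φ r)⁻¹} for every r ∈ ι, then conv is abstract, i.e. Φ(conv r) ⊇ (φ r)⁻¹ for every r ∈ ι. -/
open Set

variable {U ι : Type*}

/-- Extension of an interpretation to composite relations: `Φ(R) = ⋃_{r ∈ R} φ r`. -/
def Phi (φ : ι → Set (U × U)) (R : Set ι) : Set (U × U) := ⋃ r ∈ R, φ r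

/-- Converse of a binary relation: `s⁻¹ = {(v,u) | (u,v) ∈ s}`. -/
def RelConv (s : Set (U × U)) : Set (U × U) := {p | (p.2, p.1) ∈ s}

/-- Composition of binary relations: `s ∘ t = {(u,w) | ∃ v, (u,v) ∈ s ∧ (v,w) ∈ t}`. -/
def RelComp (s t : Set (U × U)) : Set (U × U) := {p | ∃ v, (p.1, v) ∈ s ∧ (v, p.2) ∈ t}

/-- A JEPD interpretation: each relation nonempty, pairwise disjoint, jointly exhaustive. -/
def JEPD (φ : ι → Set (U × U)) : Prop :=
  (∀ r, (φ r).Nonempty) ∧ (∀ r s, r ≠ s → Disjoint (φ r) (φ s)) ∧ (⋃ r, φ r) = Set.univ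

/-- Extension of a symbolic converse to composite relations. -/
def ConvExt (conv : ι → Set ι) (R : Set ι) : Set ι := ⋃ r ∈ R, conv r

/-- Extension of a symbolic composition to composite relations. -/
def CompExt (comp : ι → ι → Set ι) (R S : Set ι) : Set ι := ⋃ r ∈ R, ⋃ s ∈ S, comp r s

theorem weak_converse_is_abstract [Fintype ι]
    (φ : ι → Set (U × U)) (hJ : JEPD φ) (conv : ι → Set ι)
    (hweak : ∀ r : ι, conv r = ⋂₀ {S : Set ι | RelConv (φ r) ⊆ Phi φ S}) :
    ∀ r : ι, RelConv (φ r) ⊆ Phi φ (conv r) := by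
  intro r p hp
  obtain ⟨-, hdisj, hcover⟩ := hJ
  obtain ⟨t, ht⟩ := mem_iUnion.1 (hcover.symm ▸ mem_univ p : p ∈ ⋃ r, φ r)
  refine mem_biUnion (x := t) ?_ ht
  rw [hweak r]
  intro S hS
  obtain ⟨s, hs, hps⟩ := mem_iUnion₂.1 (hS hp)
  rwa [show t = s from by_contra fun hne => disjoint_left.1 (hdisj t s hne) ht hps]
end

section
/- Let φ : ι → Set (U × U) be a JEPD interpretation. If conv : ι → Set ι is a weak symbolic converse, then weakness extends to all composite relations: for every R ⊆ ι, Conv(R) = ⋂ {S : Set ι | Φ(S) ⊇ (Φ(R))⁻¹}. Likewise, if comp : ι → ι → Set ι is a weak symbolic composition, then for all R₁, R₂ ⊆ ι, Comp(R₁,R₂) = ⋂ {T : Set ι | Φ(T) ⊇ Φ(R₁) ∘ Φ(R₂)}. -/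
open Set

variable {U ι : Type*}

/-- The least composite relation covering `A` consists of the relations that meet `A`. -/
theorem JEPD.mem_sInter_iff {φ : ι → Set (U × U)} (hJ : JEPD φ) (A : Set (U × U)) (r : ι) :
    r ∈ ⋂₀ {S : Set ι | A ⊆ Phi φ S} ↔ ∃ p ∈ A, p ∈ φ r := by
  obtain ⟨-, hdisj, hunion⟩ := hJ
  constructor
  · intro h
    refine h {s | ∃ p ∈ A, p ∈ φ s} fun p hp => ?_
    obtain ⟨s, hs⟩ := mem_iUnion.1 (hunion ▸ mem_univ p)
    exact mem_iUnion₂.2 ⟨s, ⟨p, hp, hs⟩, hs⟩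
  · rintro ⟨p, hpA, hpr⟩ S hS
    obtain ⟨s, hsS, hps⟩ := mem_iUnion₂.1 (hS hpA)
    by_cases hrs : r = s
    · exact hrs ▸ hsS
    · exact (disjoint_left.1 (hdisj r s hrs) hpr hps).elim

theorem weak_ops_extend_to_composite [Fintype ι]
    (φ : ι → Set (U × U)) (hJ : JEPD φ)
    (conv : ι → Set ι) (comp : ι → ι → Set ι)
    (hconv : ∀ r : ι, conv r = ⋂₀ {S : Set ι | RelConv (φ r) ⊆ Phi φ S})
    (hcomp : ∀ r s : ι, comp r s = ⋂₀ {T : Set ι | RelComp (φ r) (φ s) ⊆ Phi φ T}) :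
    (∀ R : Set ι, ConvExt conv R = ⋂₀ {S : Set ι | RelConv (Phi φ R) ⊆ Phi φ S}) ∧
    (∀ R₁ R₂ : Set ι,
      CompExt comp R₁ R₂ = ⋂₀ {T : Set ι | RelComp (Phi φ R₁) (Phi φ R₂) ⊆ Phi φ T}) := by
  constructor
  · intro R
    ext t
    simp only [ConvExt, mem_iUnion, hconv, hJ.mem_sInter_iff, exists_prop]
    simp only [RelConv, Phi, mem_iUnion, mem_ofPred_eq, exists_prop]
    grind
  · intro R₁ R₂
    ext t
    simp only [CompExt, mem_iUnion, hcomp, hJ.mem_sInter_iff, exists_prop]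
    simp only [RelComp, Phi, mem_iUnion, mem_ofPred_eq, exists_prop]
    constructor
    · rintro ⟨r, hr, s, hs, p, ⟨v, hrv, hsv⟩, hp⟩
      exact ⟨p, ⟨v, ⟨r, hr, hrv⟩, ⟨s, hs, hsv⟩⟩, hp⟩
    · rintro ⟨p, ⟨v, ⟨r, hr, hrv⟩, ⟨s, hs, hsv⟩⟩, hp⟩
      exact ⟨r, hr, s, hs, p, ⟨v, hrv, hsv⟩, hp⟩
end

section
/- Let φ : ι → Set (U × U) be a JEPD interpretation and conv : ι → Set ι an abstract symbolic converse. Then the following three properties are equivalent: (1) conv is strong, i.e. Φ(conv r) = (φ r)⁻¹ for every r ∈ ι; (2) Axiom R7 holds for all relation symbols, i.e. Conv(conv r) = {r} for every r ∈ ι; (3) Axiom R7 holds for all composite relations, i.e. Conv(Conv(R)) = R for every R ⊆ ι. -/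
open Set

variable {U ι : Type*}

theorem strong_converse_iff_R7 [Fintype ι]
    (φ : ι → Set (U × U)) (hJ : JEPD φ) (conv : ι → Set ι)
    (habs : ∀ r : ι, RelConv (φ r) ⊆ Phi φ (conv r)) :
    ((∀ r : ι, Phi φ (conv r) = RelConv (φ r)) ↔
      (∀ r : ι, ConvExt conv (conv r) = {r})) ∧
    ((∀ r : ι, ConvExt conv (conv r) = {r}) ↔
      (∀ R : Set ι, ConvExt conv (ConvExt conv R) = R)) := by
  obtain ⟨hne, hdisj, -⟩ := hJ
  have huniq : ∀ {r s p}, p ∈ φ r → p ∈ φ s → r = s := by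
    intro r s p hr hs
    by_contra h
    exact Set.disjoint_left.mp (hdisj r s h) hr hs
  have hmem : ∀ r p, p ∈ φ r → ∃ s ∈ conv r, (p.2, p.1) ∈ φ s := by
    intro r p hp
    simpa [Phi] using habs r (show (p.2, p.1) ∈ RelConv (φ r) from hp)
  refine ⟨⟨fun hstrong r => ?_, fun hR7 r => ?_⟩, ⟨fun hR7 R => ?_, fun hR7 r => ?_⟩⟩
  · have hsub : ∀ {r s p}, s ∈ conv r → p ∈ φ s → (p.2, p.1) ∈ φ r := by
      intro r s p hs hp
      have h : p ∈ Phi φ (conv r) := Set.mem_biUnion hs hp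
      rw [hstrong r] at h
      exact h
    ext t
    simp only [ConvExt, Set.mem_iUnion, exists_prop, Set.mem_singleton_iff]
    constructor
    · rintro ⟨s, hs, ht⟩
      obtain ⟨p, hp⟩ := hne t
      exact huniq hp (hsub hs (hsub ht hp))
    · rintro rfl
      obtain ⟨p, hp⟩ := hne t
      obtain ⟨s, hs, hps⟩ := hmem t p hp
      obtain ⟨u, hu, hpu⟩ := hmem s _ hps
      exact ⟨s, hs, huniq hpu hp ▸ hu⟩
  · refine Set.Subset.antisymm ?_ (habs r)
    have hback : ∀ {r s t}, s ∈ conv r → t ∈ conv s → t = r := by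
      intro r s t hs ht
      have h : t ∈ ConvExt conv (conv r) := Set.mem_biUnion hs ht
      rw [hR7 r] at h
      exact h
    intro p hp
    obtain ⟨s, hs, hps⟩ : ∃ s ∈ conv r, p ∈ φ s := by simpa [Phi] using hp
    obtain ⟨t, ht, hpt⟩ := hmem s p hps
    exact hback hs ht ▸ hpt
  · ext t
    have h : ∀ r, (∃ s ∈ conv r, t ∈ conv s) ↔ t = r := fun r => by
      simpa [ConvExt] using Set.ext_iff.mp (hR7 r) t
    simp only [ConvExt, Set.mem_iUnion, exists_prop]
    constructor
    · rintro ⟨s, ⟨r, hr, hs⟩, ht⟩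
      exact (h r).mp ⟨s, hs, ht⟩ ▸ hr
    · intro ht
      obtain ⟨s, hs, hts⟩ := (h t).mpr rfl
      exact ⟨s, ⟨t, ht, hs⟩, hts⟩
  · simpa [ConvExt] using hR7 {r}
end

section
/- Let φ : ι → Set (U × U) be a JEPD interpretation and conv : ι → Set ι an abstract symbolic converse. Then the inclusion half R7⊇ of the involution axiom always holds at the symbolic level: for every r ∈ ι, r ∈ Conv(conv r), i.e. {r} ⊆ Conv(conv r). -/
open Set

variable {U ι : Type*}

theorem R7_sup_always_holds [Fintype ι]
    (φ : ι → Set (U × U)) (hJ : JEPD φ) (conv : ι → Set ι)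
    (habs : ∀ r : ι, RelConv (φ r) ⊆ Phi φ (conv r)) :
    ∀ r : ι, r ∈ ConvExt conv (conv r) := by
  obtain ⟨hne, hdisj, -⟩ := hJ
  intro r
  obtain ⟨⟨u, v⟩, huv⟩ := hne r
  obtain ⟨s, hs, hvu⟩ := mem_iUnion₂.1 (habs r (show (v, u) ∈ RelConv (φ r) from huv))
  obtain ⟨t, ht, huv'⟩ := mem_iUnion₂.1 (habs s (show (u, v) ∈ RelConv (φ s) from hvu))
  obtain rfl : r = t := by
    by_contra h
    exact disjoint_left.1 (hdisj r t h) huv huv'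
  exact mem_biUnion hs ht
end

section
/- Let φ : ι → Set (U × U) be a JEPD interpretation and comp : ι → ι → Set ι an abstract symbolic composition. Then the inclusion half SA⊇ of semi-associativity always holds at the symbolic level: for every composite relation R ⊆ ι, Comp(R, univ) ⊆ Comp(Comp(R, univ), univ), where univ = Set.univ ⊆ ι is the universal composite relation (the set of all relation symbols). -/
open Set

variable {U ι : Type*}

/-- Under an abstract composition every composite relation lies in its composition with the
universal one. -/
theorem subset_compExt_univ {φ : ι → Set (U × U)} (hJ : JEPD φ) {comp : ι → ι → Set ι}
    (habs : ∀ r s : ι, RelComp (φ r) (φ s) ⊆ Phi φ (comp r s)) (R : Set ι) :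
    R ⊆ CompExt comp R Set.univ := by
  obtain ⟨hne, hdisj, huniv⟩ := hJ
  intro r hr
  obtain ⟨⟨u, v⟩, huv⟩ := hne r
  obtain ⟨s, hs⟩ : ∃ s, (v, v) ∈ φ s := mem_iUnion.1 (huniv ▸ mem_univ (v, v))
  obtain ⟨t, ht, hut⟩ := mem_iUnion₂.1 (habs r s (show (u, v) ∈ RelComp (φ r) (φ s) from ⟨v, huv, hs⟩))
  have hrt : r = t := by
    by_contra h
    exact Set.disjoint_left.1 (hdisj r t h) huv hut
  exact mem_iUnion₂.2 ⟨r, hr, mem_iUnion₂.2 ⟨s, mem_univ s, hrt ▸ ht⟩⟩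

theorem SA_sup_always_holds [Fintype ι]
    (φ : ι → Set (U × U)) (hJ : JEPD φ) (comp : ι → ι → Set ι)
    (habs : ∀ r s : ι, RelComp (φ r) (φ s) ⊆ Phi φ (comp r s)) :
    ∀ R : Set ι,
      CompExt comp R Set.univ ⊆ CompExt comp (CompExt comp R Set.univ) Set.univ := by
  exact fun R => biUnion_subset_biUnion_left (subset_compExt_univ hJ habs R)
end

section
/- Let φ : ι → Set (U × U) be a JEPD interpretation and comp : ι → ι → Set ι a strong symbolic composition. Then the extended symbolic composition is associative (Axiom R4): for all composite relations R, S, T ⊆ ι, Comp(Comp(R,S), T) = Comp(R, Comp(S,T)). -/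
open Set

variable {U ι : Type*}

theorem mem_Phi {φ : ι → Set (U × U)} {R : Set ι} {p : U × U} :
    p ∈ Phi φ R ↔ ∃ r ∈ R, p ∈ φ r := by
  simp [Phi]

/-- A pairwise disjoint family of nonempty relations interprets composite relations injectively. -/
theorem Phi_injective {φ : ι → Set (U × U)} (hne : ∀ r, (φ r).Nonempty)
    (hdisj : ∀ r s, r ≠ s → Disjoint (φ r) (φ s)) : Function.Injective (Phi φ) := by
  have mem_iff {R : Set ι} {r : ι} {p : U × U} (hp : p ∈ φ r) : p ∈ Phi φ R ↔ r ∈ R := by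
    refine ⟨fun h => ?_, fun hr => mem_Phi.2 ⟨r, hr, hp⟩⟩
    obtain ⟨s, hs, hps⟩ := mem_Phi.1 h
    by_contra hr
    have hrs : r ≠ s := fun h => hr (h ▸ hs)
    exact Set.disjoint_left.1 (hdisj r s hrs) hp hps
  intro R S h
  ext r
  obtain ⟨p, hp⟩ := hne r
  rw [← mem_iff hp, h, mem_iff hp]

theorem Phi_CompExt {φ : ι → Set (U × U)} {comp : ι → ι → Set ι}
    (hstrong : ∀ r s : ι, Phi φ (comp r s) = RelComp (φ r) (φ s)) (R S : Set ι) :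
    Phi φ (CompExt comp R S) = RelComp (Phi φ R) (Phi φ S) := by
  ext p
  constructor
  · intro h
    obtain ⟨t, ht, hp⟩ := mem_Phi.1 h
    simp only [CompExt, Set.mem_iUnion] at ht
    obtain ⟨r, hr, s, hs, ht⟩ := ht
    have hpc : p ∈ RelComp (φ r) (φ s) := hstrong r s ▸ mem_Phi.2 ⟨t, ht, hp⟩
    obtain ⟨v, h₁, h₂⟩ := hpc
    exact ⟨v, mem_Phi.2 ⟨r, hr, h₁⟩, mem_Phi.2 ⟨s, hs, h₂⟩⟩
  · rintro ⟨v, h₁, h₂⟩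
    obtain ⟨r, hr, h₁⟩ := mem_Phi.1 h₁
    obtain ⟨s, hs, h₂⟩ := mem_Phi.1 h₂
    have hpc : p ∈ Phi φ (comp r s) := by
      rw [hstrong]
      exact ⟨v, h₁, h₂⟩
    obtain ⟨t, ht, hp⟩ := mem_Phi.1 hpc
    refine mem_Phi.2 ⟨t, ?_, hp⟩
    simp only [CompExt, Set.mem_iUnion]
    exact ⟨r, hr, s, hs, ht⟩

theorem RelComp_assoc (s t u : Set (U × U)) :
    RelComp (RelComp s t) u = RelComp s (RelComp t u) := by
  ext p
  constructor
  · rintro ⟨v, ⟨w, h₁, h₂⟩, h₃⟩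
    exact ⟨w, h₁, v, h₂, h₃⟩
  · rintro ⟨w, h₁, v, h₂, h₃⟩
    exact ⟨v, ⟨w, h₁, h₂⟩, h₃⟩

theorem strong_composition_implies_R4 [Fintype ι]
    (φ : ι → Set (U × U)) (hJ : JEPD φ) (comp : ι → ι → Set ι)
    (hstrong : ∀ r s : ι, Phi φ (comp r s) = RelComp (φ r) (φ s)) :
    ∀ R S T : Set ι,
      CompExt comp (CompExt comp R S) T = CompExt comp R (CompExt comp S T) := by
  intro R S T
  apply Phi_injective hJ.1 hJ.2.1
  simp only [Phi_CompExt hstrong, RelComp_assoc]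
end

section
/- Let A be a Boolean algebra additionally equipped with a binary operation ⋄ and a unary operation ˘ satisfying Axioms R5, R7, R8, and R9. Then the Tarski/de Morgan axiom R10 holds for all r, s ∈ A if and only if the Peircean law PL holds for all r, s, t ∈ A. -/
theorem conv_inf_eq_bot {A : Type*} [BooleanAlgebra A] {conv : A → A}
    (R7 : ∀ r : A, conv (conv r) = r)
    (R8 : ∀ r s : A, conv (r ⊔ s) = conv r ⊔ conv s) {x y : A} (h : x ⊓ y = ⊥) :
    conv x ⊓ conv y = ⊥ := by
  have mono : Monotone conv := fun a b hab => by
    rw [← sup_eq_right, ← R8, sup_eq_right.mpr hab]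
  have le_inf : conv (conv x ⊓ conv y) ≤ x ⊓ y :=
    le_inf ((mono inf_le_left).trans_eq (R7 x)) ((mono inf_le_right).trans_eq (R7 y))
  have le_bot : conv (conv x ⊓ conv y) ≤ conv ⊥ := (le_inf.trans_eq h).trans bot_le
  simpa only [R7, le_bot_iff] using (mono le_bot).trans_eq (R7 ⊥)

theorem comp_le_comp_left {A : Type*} [BooleanAlgebra A] {comp : A → A → A} {conv : A → A}
    (R5 : ∀ r s t : A, comp (r ⊔ s) t = comp r t ⊔ comp s t)
    (R7 : ∀ r : A, conv (conv r) = r)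
    (R8 : ∀ r s : A, conv (r ⊔ s) = conv r ⊔ conv s)
    (R9 : ∀ r s : A, conv (comp r s) = comp (conv s) (conv r))
    {s t : A} (r : A) (h : s ≤ t) : comp r s ≤ comp r t := by
  have key : comp r (s ⊔ t) = comp r s ⊔ comp r t := by
    rw [← R7 (comp r (s ⊔ t)), R9, R8, R5, R8, R9, R9, R7, R7, R7]
  rw [← sup_eq_right, ← key, sup_eq_right.mpr h]

theorem R10_iff_PL {A : Type*} [BooleanAlgebra A]
    (comp : A → A → A) (conv : A → A)
    (R5 : ∀ r s t : A, comp (r ⊔ s) t = comp r t ⊔ comp s t)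
    (R7 : ∀ r : A, conv (conv r) = r)
    (R8 : ∀ r s : A, conv (r ⊔ s) = conv r ⊔ conv s)
    (R9 : ∀ r s : A, conv (comp r s) = comp (conv s) (conv r)) :
    (∀ r s : A, comp (conv r) (comp r s)ᶜ ⊔ sᶜ = sᶜ) ↔
    (∀ r s t : A, comp r s ⊓ conv t = ⊥ ↔ comp s t ⊓ conv r = ⊥) := by
  constructor
  · intro R10
    have rotate : ∀ r s t : A, comp r s ⊓ conv t = ⊥ → comp t r ⊓ conv s = ⊥ := by
      intro r s t h
      have le_compl : conv t ≤ (comp r s)ᶜ :=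
        (disjoint_iff.mpr h).symm.le_compl_right
      have comp_le : comp (conv r) (conv t) ≤ sᶜ :=
        (comp_le_comp_left R5 R7 R8 R9 _ le_compl).trans (sup_eq_right.mp (R10 r s))
      have inf_eq : comp (conv r) (conv t) ⊓ s = ⊥ :=
        (le_compl_iff_disjoint_right.mp comp_le).eq_bot
      simpa only [R9, R7] using conv_inf_eq_bot R7 R8 inf_eq
    exact fun r s t => ⟨fun h => rotate _ _ _ (rotate _ _ _ h), rotate _ _ _⟩
  · intro PL r s
    have h : comp r s ⊓ conv (conv (comp r s)ᶜ) = ⊥ := by rw [R7, inf_compl_eq_bot]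
    have inf_eq := conv_inf_eq_bot R7 R8 ((PL _ _ _).mp ((PL _ _ _).mp h))
    rw [R9, R7, R7] at inf_eq
    exact sup_eq_right.mpr (disjoint_iff.mpr inf_eq).le_compl_right
end

section
/- There exist a type U, a JEPD interpretation φ : ι → Set (U × U) with ι a four-element type, an abstract symbolic converse conv, and an abstract symbolic composition comp such that the extended symbolic composition is not associative (there are r, s, t ∈ ι with Comp(Comp({r},{s}), {t}) ≠ Comp({r}, Comp({s},{t}))) and the involutive distributivity axiom R9 fails (there are r, s ∈ ι with Conv(comp r s) ≠ Comp(conv s, conv r)). -/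
open Set

variable {U ι : Type*}

theorem exists_calculus_violating_R4_R9 :
    ∃ (U : Type) (φ : Fin 4 → Set (U × U)) (conv : Fin 4 → Set (Fin 4))
      (comp : Fin 4 → Fin 4 → Set (Fin 4)),
      JEPD φ ∧
      (∀ r : Fin 4, RelConv (φ r) ⊆ Phi φ (conv r)) ∧
      (∀ r s : Fin 4, RelComp (φ r) (φ s) ⊆ Phi φ (comp r s)) ∧
      (∃ r s t : Fin 4,
        CompExt comp (CompExt comp {r} {s}) {t} ≠ CompExt comp {r} (CompExt comp {s} {t})) ∧
      (∃ r s : Fin 4, ConvExt conv (comp r s) ≠ CompExt comp (conv s) (conv r)) := by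
  refine ⟨Bool, fun r => {(decide (2 ≤ r), decide (r = 1 ∨ r = 3))}, fun _ => univ,
    fun r s => {_x | ¬(r = 0 ∧ s = 3)}, ⟨fun r => singleton_nonempty _, ?_, ?_⟩, ?_, ?_,
    ⟨0, 3, 3, ?_⟩, ⟨0, 3, ?_⟩⟩
  · simp only [disjoint_singleton]
    decide
  · simp only [eq_univ_iff_forall, mem_iUnion, mem_singleton_iff]
    decide
  · simp only [subset_def, RelConv, Phi, mem_iUnion, mem_ofPred_eq, mem_singleton_iff, mem_univ]
    decide
  · simp only [subset_def, RelComp, Phi, mem_iUnion, mem_ofPred_eq, mem_singleton_iff]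
    decide
  · intro h
    have h0 := Set.ext_iff.1 h 0
    simp only [CompExt, mem_iUnion, exists_prop, mem_ofPred_eq, mem_singleton_iff] at h0
    revert h0
    decide
  · intro h
    have h0 := Set.ext_iff.1 h 0
    simp only [ConvExt, CompExt, mem_iUnion, exists_prop, mem_ofPred_eq, mem_univ] at h0
    revert h0
    decide
end

section
/- Let φ : ι → Set (U × U) be a JEPD interpretation and comp : ι → ι → Set ι an abstract symbolic composition. Then the refinement step of the algebraic closure algorithm is sound, i.e. it removes no solutions: for all composite relations R, R₁, R₂ ⊆ ι and all u, v, w ∈ U, if (u,w) ∈ Φ(R), (u,v) ∈ Φ(R₁), and (v,w) ∈ Φ(R₂), then (u,w) ∈ Φ(R ∩ Comp(R₁,R₂)). -/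
open Set

variable {U ι : Type*}

theorem aclosure_refinement_sound [Fintype ι]
    (φ : ι → Set (U × U)) (hJ : JEPD φ) (comp : ι → ι → Set ι)
    (habs : ∀ r s : ι, RelComp (φ r) (φ s) ⊆ Phi φ (comp r s)) :
    ∀ (R R₁ R₂ : Set ι) (u v w : U),
      (u, w) ∈ Phi φ R → (u, v) ∈ Phi φ R₁ → (v, w) ∈ Phi φ R₂ →
      (u, w) ∈ Phi φ (R ∩ CompExt comp R₁ R₂) := by
  simp only [Phi, CompExt, mem_iUnion, mem_inter_iff, exists_prop]
  rintro R R₁ R₂ u v w ⟨r, hr, huw⟩ ⟨r₁, hr₁, huv⟩ ⟨r₂, hr₂, hvw⟩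
  have hcomp : (u, w) ∈ Phi φ (comp r₁ r₂) := habs r₁ r₂ ⟨v, huv, hvw⟩
  simp only [Phi, mem_iUnion, exists_prop] at hcomp
  obtain ⟨t, ht, htuw⟩ := hcomp
  obtain rfl : r = t := by
    by_contra hne
    exact disjoint_left.mp (hJ.2.1 r t hne) huw htuw
  exact ⟨r, ⟨hr, r₁, hr₁, r₂, hr₂, ht⟩, huw⟩
end

section
/- Let φ : ι → Set (U × U) be a JEPD interpretation and comp : ι → ι → Set ι a strong symbolic composition. Then algebraic closure and path-consistency coincide on each triangle of constraints: for all composite relations R, R₁, R₂ ⊆ ι, R ⊆ Comp(R₁,R₂) if and only if Φ(R) ⊆ Φ(R₁) ∘ Φ(R₂). -/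
open Set

variable {U ι : Type*}

theorem mem_CompExt {comp : ι → ι → Set ι} {R S : Set ι} {t : ι} :
    t ∈ CompExt comp R S ↔ ∃ r ∈ R, ∃ s ∈ S, t ∈ comp r s := by
  simp [CompExt]

/-- A JEPD interpretation reflects and preserves inclusion of composite relations. -/
theorem JEPD.Phi_subset_Phi_iff {φ : ι → Set (U × U)} (hJ : JEPD φ) {R S : Set ι} :
    Phi φ R ⊆ Phi φ S ↔ R ⊆ S := by
  refine ⟨fun h r hr => ?_, fun h => biUnion_subset_biUnion_left h⟩
  obtain ⟨p, hp⟩ := hJ.1 r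
  obtain ⟨s, hs, hps⟩ := mem_Phi.1 (h (mem_Phi.2 ⟨r, hr, hp⟩))
  by_contra hrS
  exact disjoint_left.1 (hJ.2.1 r s fun hrs => hrS (hrs ▸ hs)) hp hps

theorem aclosure_eq_path_consistency_of_strong [Fintype ι]
    (φ : ι → Set (U × U)) (hJ : JEPD φ) (comp : ι → ι → Set ι)
    (hstrong : ∀ r s : ι, Phi φ (comp r s) = RelComp (φ r) (φ s)) :
    ∀ R R₁ R₂ : Set ι,
      R ⊆ CompExt comp R₁ R₂ ↔ Phi φ R ⊆ RelComp (Phi φ R₁) (Phi φ R₂) := by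
  intro R R₁ R₂
  rw [← Phi_CompExt hstrong, hJ.Phi_subset_Phi_iff]
end
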